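/- An example with an exactly-L² potential: Fix 0 < ε < 1/2 and define on the punctured disk D_{1/2} \ {0}: u₀(z) = e^{−(−ln|z|)^ε} and V(z) = ε / (2|z|(−ln|z|)^{1−ε}). Then: (i) V ∈ L²(D_{1/2}), i.e. ∫_{|z|<1/2} V(z)² dv_z < ∞; (ii) V ∉ L^p(D_{1/2}) for every p > 2, i.e. ∫_{|z|<1/2} V(z)^p dv_z = ∞ for all p > 2; (iii) u₀ is differentiable on D_{1/2} \ {0} and satisfies |∂̄u₀(z)| = V(z)|u₀(z)| for every z ∈ D_{1/2} \ {0}, where ∂̄ = (∂_x + i∂_y)/2; and (iv) u₀ (extended by 0 at the origin) does not vanish to infinite order at 0: there exists m ≥ 0 (indeed any m ≥ 3 works) such that r^{−m} ∫_{|z|<r} |u₀(z)|² dv_z does not tend to 0 as r → 0⁺. -/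

import Mathlib

open MeasureTheory Metric Filter Topology

/-- The (pointwise) `∂̄`-operator: `∂̄u(z) = (∂_x u(z) + i ∂_y u(z))/2`, computed from the
real Fréchet derivative. -/
noncomputable def dbar (u : ℂ → ℂ) (z : ℂ) : ℂ :=
  (fderiv ℝ u z 1 + Complex.I * fderiv ℝ u z Complex.I) / 2

/-- The function `u₀(z) = e^{−(−ln|z|)^ε}` for `z ≠ 0`, extended by `0` at the origin. -/
noncomputable def uLog (ε : ℝ) (z : ℂ) : ℂ :=
  if z = 0 then 0 else ((Real.exp (-((-Real.log ‖z‖) ^ ε)) : ℝ) : ℂ)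

/-- The potential `V(z) = ε/(2|z|(−ln|z|)^{1−ε})`. -/
noncomputable def VLog (ε : ℝ) (z : ℂ) : ℝ :=
  ε / (2 * ‖z‖ * (-Real.log ‖z‖) ^ (1 - ε))

theorem measurable_VLog (ε : ℝ) : Measurable (VLog ε) := by
  unfold VLog
  fun_prop

theorem measurable_uLog (ε : ℝ) : Measurable (uLog ε) := by
  unfold uLog
  exact Measurable.ite (measurableSet_singleton 0) measurable_const (by fun_prop)

theorem norm_uLog {ε : ℝ} {z : ℂ} (hz : z ≠ 0) :
    ‖uLog ε z‖ = Real.exp (-((-Real.log ‖z‖) ^ ε)) := by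
  rw [uLog, if_neg hz, Complex.norm_real, Real.norm_of_nonneg (Real.exp_pos _).le]

theorem VLog_nonneg {ε : ℝ} (hε : 0 ≤ ε) {z : ℂ} (hz : ‖z‖ ≤ 1) : 0 ≤ VLog ε z := by
  have : 0 ≤ -Real.log ‖z‖ := neg_nonneg.2 (Real.log_nonpos (norm_nonneg z) hz)
  unfold VLog
  positivity

/-- `1/(r (-log r)^(1+a))` is integrable on `(0, b]` for `a > 0` and `b < 1`. -/
theorem integrableOn_inv_mul_neg_log_rpow {a : ℝ} (ha : 0 < a) {b : ℝ} (hb : b < 1) :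
    IntegrableOn (fun r : ℝ => r⁻¹ * (-Real.log r) ^ (-a - 1)) (Set.Ioc 0 b) := by
  have hlog : ∀ r ∈ Set.Ioc 0 b, 0 < -Real.log r := fun r hr =>
    neg_pos.2 (Real.log_neg hr.1 (hr.2.trans_lt hb))
  have hderiv : ∀ r ∈ Set.Ioc 0 b, HasDerivAt (fun r : ℝ => a⁻¹ * (-Real.log r) ^ (-a))
      (r⁻¹ * (-Real.log r) ^ (-a - 1)) r := by
    intro r hr
    have h := (((Real.hasDerivAt_log hr.1.ne').neg).rpow_const (p := -a)
      (Or.inl (hlog r hr).ne')).const_mul a⁻¹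
    refine h.congr_deriv ?_
    simp only [Pi.neg_apply]
    field_simp
  refine intervalIntegral.integrableOn_deriv_of_nonneg
    (g := fun r : ℝ => a⁻¹ * (-Real.log r) ^ (-a)) ?_ (fun r hr => hderiv r ⟨hr.1, hr.2.le⟩) ?_
  · intro r hr
    rcases hr.1.eq_or_lt with rfl | h0
    · rw [← continuousWithinAt_sdiff_self]
      have h1 : Tendsto (fun r : ℝ => -Real.log r) (𝓝[Set.Icc 0 b \ {0}] 0) atTop := by
        refine tendsto_neg_atBot_atTop.comp (Real.tendsto_log_nhdsNE_zero.mono_left ?_)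
        exact nhdsWithin_mono _ fun x hx => hx.2
      have h2 := ((tendsto_rpow_neg_atTop ha).comp h1).const_mul a⁻¹
      have h3 : a⁻¹ * (-Real.log 0) ^ (-a) = a⁻¹ * 0 := by
        simp [Real.zero_rpow (neg_ne_zero.2 ha.ne')]
      rw [← h3] at h2
      exact h2
    · exact (hderiv r ⟨h0, hr.2⟩).continuousAt.continuousWithinAt
  · intro r hr
    have := hlog r ⟨hr.1, hr.2.le⟩
    have := hr.1
    positivity

theorem lintegral_VLog_sq_lt_top {ε : ℝ} (hε : ε < 1 / 2) :
    (∫⁻ z in ball (0 : ℂ) (1 / 2), ENNReal.ofReal (VLog ε z ^ 2)) < ⊤ := by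
  have hint : IntegrableOn (fun z : ℂ => VLog ε z ^ 2) (ball 0 (1 / 2)) := by
    refine (integrableOn_fun_norm_addHaar (volume : Measure ℂ)
      (f := fun r : ℝ => (ε / (2 * r * (-Real.log r) ^ (1 - ε))) ^ 2)).2 ?_
    have h := ((integrableOn_inv_mul_neg_log_rpow (a := 1 - 2 * ε) (b := 1 / 2) (by linarith)
      (by norm_num)).mono_set Set.Ioo_subset_Ioc_self).const_mul (ε ^ 2 / 4)
    refine IntegrableOn.congr_fun h (fun r hr => ?_) measurableSet_Ioo
    have hr0 : 0 < r := hr.1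
    have hL : 0 < -Real.log r := neg_pos.2 (Real.log_neg hr0 (hr.2.trans (by norm_num)))
    have hpow : (-Real.log r) ^ (-(1 - 2 * ε) - 1) = (((-Real.log r) ^ (1 - ε)) ^ 2)⁻¹ := by
      rw [← Real.rpow_natCast, ← Real.rpow_mul hL.le, ← Real.rpow_neg hL.le]
      congr 1
      push_cast
      ring
    have hP : 0 < (-Real.log r) ^ (1 - ε) := Real.rpow_pos_of_pos hL _
    simp only [Complex.finrank_real_complex, smul_eq_mul, hpow]
    field_simp
    ring
  refine lt_of_le_of_lt (lintegral_mono fun z => ?_) hint.2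
  rw [← ofReal_norm]
  exact ENNReal.ofReal_le_ofReal (le_abs_self _)

theorem not_integrableOn_Ioo_inv {δ : ℝ} (hδ : 0 < δ) :
    ¬ IntegrableOn (fun r : ℝ => r⁻¹) (Set.Ioo 0 δ) := by
  intro h
  have h' := (intervalIntegrable_iff_integrableOn_Ioo_of_le hδ.le).2 h
  rw [intervalIntegrable_inv_iff] at h'
  rcases h' with h' | h'
  · exact hδ.ne h'
  · exact h' Set.left_mem_uIcc

theorem lintegral_VLog_rpow_eq_top {ε : ℝ} (hε0 : 0 < ε) (hε : ε < 1) {p : ℝ} (hp : 2 < p) :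
    (∫⁻ z in ball (0 : ℂ) (1 / 2), ENNReal.ofReal (VLog ε z ^ p)) = ⊤ := by
  by_contra hne
  have hp0 : 0 < p := by linarith
  have hint : IntegrableOn (fun z : ℂ => VLog ε z ^ p) (ball 0 (1 / 2)) := by
    refine (lintegral_ofReal_ne_top_iff_integrable
      ((measurable_VLog ε).pow_const p).aestronglyMeasurable ?_).1 hne
    refine ae_restrict_of_forall_mem measurableSet_ball fun z hz => ?_
    refine Real.rpow_nonneg (VLog_nonneg hε0.le ?_) p
    linarith [mem_ball_zero_iff.1 hz]
  have hrad := (integrableOn_fun_norm_addHaar (volume : Measure ℂ)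
      (f := fun r : ℝ => (ε / (2 * r * (-Real.log r) ^ (1 - ε))) ^ p)).1 hint
  have hs : 2 / p - 1 < 0 := by
    rw [sub_neg, div_lt_one hp0]
    exact hp
  have hsmall := (isLittleO_abs_log_rpow_rpow_nhdsGT_zero (1 - ε) hs).bound one_pos
  obtain ⟨δ, hδ0, hδ⟩ := mem_nhdsGT_iff_exists_Ioo_subset.1 hsmall
  have hδ0 : 0 < δ := hδ0
  refine not_integrableOn_Ioo_inv (δ := min δ (1 / 2)) (by positivity) ?_
  have hdom := (hrad.mono_set (Set.Ioo_subset_Ioo_right (min_le_right δ (1 / 2)))).const_mul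
    (((ε / 2) ^ p)⁻¹)
  refine Integrable.mono' hdom (by fun_prop) ?_
  refine ae_restrict_of_forall_mem measurableSet_Ioo fun r hr => ?_
  have hr0 : 0 < r := hr.1
  have hrδ := lt_min_iff.1 hr.2
  have hL : 0 < -Real.log r := neg_pos.2 (Real.log_neg hr0 (by linarith))
  have hbound : (-Real.log r) ^ (1 - ε) ≤ r ^ (2 / p - 1) := by
    have h : ‖|Real.log r| ^ (1 - ε)‖ ≤ 1 * ‖r ^ (2 / p - 1)‖ := hδ ⟨hr0, hrδ.1⟩
    rw [← abs_of_pos hL, abs_neg]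
    rwa [one_mul, Real.norm_of_nonneg (by positivity), Real.norm_of_nonneg (by positivity)] at h
  have hP : 0 < (-Real.log r) ^ (1 - ε) := Real.rpow_pos_of_pos hL _
  have hpow : (r * (-Real.log r) ^ (1 - ε)) ^ p ≤ r ^ 2 := by
    calc (r * (-Real.log r) ^ (1 - ε)) ^ p ≤ (r * r ^ (2 / p - 1)) ^ p := by gcongr
      _ = (r ^ (2 / p)) ^ p := by
        rw [Real.rpow_sub_one hr0.ne']
        congr 1
        field_simp
      _ = r ^ 2 := by
        rw [← Real.rpow_mul hr0.le, div_mul_cancel₀ _ hp0.ne', Real.rpow_two]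
  have hsplit : (ε / (2 * r * (-Real.log r) ^ (1 - ε))) ^ p
      = (ε / 2) ^ p / (r * (-Real.log r) ^ (1 - ε)) ^ p := by
    rw [← Real.div_rpow (by positivity) (by positivity)]
    congr 1
    field_simp
  have hE : 0 < (ε / 2) ^ p := by positivity
  have hQ : 0 < (r * (-Real.log r) ^ (1 - ε)) ^ p := by positivity
  simp only [Complex.finrank_real_complex, smul_eq_mul, hsplit]
  rw [Real.norm_of_nonneg (by positivity)]
  have hrw : ((ε / 2) ^ p)⁻¹ * (r ^ (2 - 1) * ((ε / 2) ^ p / (r * (-Real.log r) ^ (1 - ε)) ^ p))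
      = r / (r * (-Real.log r) ^ (1 - ε)) ^ p := by
    field_simp
    norm_num
  rw [hrw, inv_eq_one_div, div_le_div_iff₀ hr0 hQ]
  nlinarith

theorem hasFDerivAt_norm_of_ne_zero {F : Type*} [NormedAddCommGroup F] [InnerProductSpace ℝ F]
    {z : F} (hz : z ≠ 0) : HasFDerivAt (fun w : F => ‖w‖) (‖z‖⁻¹ • innerSL ℝ z) z := by
  have hz' : ‖z‖ ≠ 0 := norm_ne_zero_iff.2 hz
  have h := (hasStrictFDerivAt_norm_sq z).hasFDerivAt.sqrt (pow_ne_zero 2 hz')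
  simp only [Real.sqrt_sq (norm_nonneg _)] at h
  refine h.congr_fderiv ?_
  ext v
  simp
  field_simp

/-- The modulus of the `∂̄`-derivative of a radial real-valued function is half that of its
radial derivative. -/
theorem differentiableAt_and_norm_dbar_radial {f : ℝ → ℝ} {f' : ℝ} {z : ℂ} (hz : z ≠ 0)
    (hf : HasDerivAt f f' ‖z‖) :
    DifferentiableAt ℝ (fun w : ℂ => ((f ‖w‖ : ℝ) : ℂ)) z ∧
      ‖dbar (fun w : ℂ => ((f ‖w‖ : ℝ) : ℂ)) z‖ = |f'| / 2 := by
  have hz' : ‖z‖ ≠ 0 := norm_ne_zero_iff.2 hz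
  have h := Complex.ofRealCLM.hasFDerivAt.comp z
    (hf.comp_hasFDerivAt z (hasFDerivAt_norm_of_ne_zero hz))
  refine ⟨h.differentiableAt, ?_⟩
  have hd : dbar (fun w : ℂ => ((f ‖w‖ : ℝ) : ℂ)) z = ((f' * ‖z‖⁻¹ / 2 : ℝ) : ℂ) * z := by
    unfold dbar
    rw [show fderiv ℝ (fun w : ℂ => ((f ‖w‖ : ℝ) : ℂ)) z = _ from h.fderiv]
    apply Complex.ext <;> simp [Complex.inner] <;> ring
  rw [hd, norm_mul, Complex.norm_real, Real.norm_eq_abs, abs_div, abs_mul, abs_inv, abs_norm,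
    abs_two]
  field_simp

theorem differentiableAt_uLog_and_norm_dbar {ε : ℝ} (hε : 0 ≤ ε) {z : ℂ} (hz1 : ‖z‖ < 1)
    (hz : z ≠ 0) :
    DifferentiableAt ℝ (uLog ε) z ∧ ‖dbar (uLog ε) z‖ = VLog ε z * ‖uLog ε z‖ := by
  have hr : 0 < ‖z‖ := norm_pos_iff.2 hz
  have hL : 0 < -Real.log ‖z‖ := neg_pos.2 (Real.log_neg hr hz1)
  have hf := ((((Real.hasDerivAt_log hr.ne').neg).rpow_const (p := ε) (Or.inl hL.ne')).neg).exp
  obtain ⟨hdiff, hnorm⟩ := differentiableAt_and_norm_dbar_radial hz hf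
  have heq : uLog ε =ᶠ[𝓝 z]
      fun w : ℂ => ((Real.exp (-((-Real.log ‖w‖) ^ ε)) : ℝ) : ℂ) := by
    filter_upwards [isOpen_ne.mem_nhds hz] with w hw
    exact if_neg hw
  refine ⟨hdiff.congr_of_eventuallyEq heq, ?_⟩
  have hdbar : dbar (uLog ε) z
      = dbar (fun w : ℂ => ((Real.exp (-((-Real.log ‖w‖) ^ ε)) : ℝ) : ℂ)) z := by
    unfold dbar
    rw [heq.fderiv_eq]
  rw [hdbar]
  refine hnorm.trans ?_
  rw [norm_uLog hz, VLog]
  have hP : 0 < (-Real.log ‖z‖) ^ (1 - ε) := Real.rpow_pos_of_pos hL _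
  have hpow : (-Real.log ‖z‖) ^ (ε - 1) = ((-Real.log ‖z‖) ^ (1 - ε))⁻¹ := by
    rw [← Real.rpow_neg hL.le, neg_sub]
  simp only [Pi.neg_apply, hpow]
  rw [abs_of_nonneg]
  · field_simp
  · have : -(-‖z‖⁻¹ * ε * ((-Real.log ‖z‖) ^ (1 - ε))⁻¹)
        = ‖z‖⁻¹ * ε * ((-Real.log ‖z‖) ^ (1 - ε))⁻¹ := by ring
    rw [this]
    positivity

/-- Near the origin, `|u₀|²` dominates `|z|`. -/
theorem eventually_le_exp_neg_log_rpow_sq {ε : ℝ} (hε : ε < 1) :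
    ∀ᶠ r in 𝓝[>] (0 : ℝ), r ≤ Real.exp (-((-Real.log r) ^ ε)) ^ 2 := by
  have hL : Tendsto (fun r : ℝ => -Real.log r) (𝓝[>] 0) atTop :=
    tendsto_neg_atBot_atTop.comp Real.tendsto_log_nhdsGT_zero
  have h2 := ((tendsto_rpow_atTop (sub_pos.2 hε)).comp hL).eventually_ge_atTop 2
  filter_upwards [h2, hL.eventually_gt_atTop 0, self_mem_nhdsWithin] with r h2 hL hr
  have hprod : (-Real.log r) ^ ε * (-Real.log r) ^ (1 - ε) = -Real.log r := by
    rw [← Real.rpow_add hL, add_sub_cancel, Real.rpow_one]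
  have hle : (-Real.log r) ^ ε * 2 ≤ -Real.log r :=
    (mul_le_mul_of_nonneg_left h2 (Real.rpow_nonneg hL.le _)).trans_eq hprod
  calc r = Real.exp (Real.log r) := (Real.exp_log hr).symm
    _ ≤ Real.exp ((2 : ℕ) * -((-Real.log r) ^ ε)) := by
      apply Real.exp_le_exp.2
      push_cast
      linarith
    _ = _ := Real.exp_nat_mul _ 2

theorem norm_uLog_le_one (ε : ℝ) {z : ℂ} (hz : ‖z‖ ≤ 1) : ‖uLog ε z‖ ≤ 1 := by
  by_cases h : z = 0
  · simp [uLog, h]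
  · rw [norm_uLog h, Real.exp_le_one_iff, neg_nonpos]
    exact Real.rpow_nonneg (neg_nonneg.2 (Real.log_nonpos (norm_nonneg z) hz)) _

theorem eventually_le_integral_norm_uLog_sq {ε : ℝ} (hε : ε < 1) :
    ∀ᶠ r in 𝓝[>] (0 : ℝ), Real.pi / 32 * r ^ 3 ≤ ∫ z in ball (0 : ℂ) r, ‖uLog ε z‖ ^ 2 := by
  obtain ⟨δ, hδ0, hδ⟩ :=
    mem_nhdsGT_iff_exists_Ioo_subset.1 (eventually_le_exp_neg_log_rpow_sq hε)
  have hδ0 : 0 < δ := hδ0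
  filter_upwards [Ioo_mem_nhdsGT (lt_min hδ0 one_pos)] with r hr
  have hr0 : 0 < r := hr.1
  have hrδ := lt_min_iff.1 hr.2
  set c : ℂ := ((3 * r / 4 : ℝ) : ℂ) with hc
  have hcn : ‖c‖ = 3 * r / 4 := by
    rw [hc, Complex.norm_real, Real.norm_of_nonneg (by positivity)]
  have hsub : ball c (r / 4) ⊆ ball 0 r := by
    refine ball_subset_ball' ?_
    rw [dist_zero_right, hcn]
    linarith
  have hint : IntegrableOn (fun z : ℂ => ‖uLog ε z‖ ^ 2) (ball 0 r) := by
    refine Measure.integrableOn_of_bounded (M := 1) measure_ball_lt_top.ne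
      ((measurable_uLog ε).norm.pow_const 2).aestronglyMeasurable ?_
    refine ae_restrict_of_forall_mem measurableSet_ball fun z hz => ?_
    rw [norm_pow, norm_norm]
    refine pow_le_one₀ (norm_nonneg _) (norm_uLog_le_one ε ?_)
    linarith [mem_ball_zero_iff.1 hz]
  have hlow : ∀ z ∈ ball c (r / 4), r / 2 ≤ ‖uLog ε z‖ ^ 2 := by
    intro z hz
    have hzr := mem_ball_zero_iff.1 (hsub hz)
    have h1 : ‖c‖ - ‖z‖ < r / 4 :=
      (norm_sub_norm_le c z).trans_lt (by rwa [← dist_eq_norm, dist_comm])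
    have hz2 : r / 2 ≤ ‖z‖ := by linarith
    have hz0 : 0 < ‖z‖ := by linarith
    rw [norm_uLog (norm_pos_iff.1 hz0)]
    exact hz2.trans (hδ ⟨hz0, hzr.trans hrδ.1⟩)
  calc Real.pi / 32 * r ^ 3 = r / 2 * volume.real (ball c (r / 4)) := by
        rw [Measure.real, Complex.volume_ball]
        simp [ENNReal.toReal_ofReal (by positivity : 0 ≤ r / 4)]
        ring
    _ ≤ ∫ z in ball c (r / 4), ‖uLog ε z‖ ^ 2 :=
        setIntegral_ge_of_const_le_real measurableSet_ball measure_ball_lt_top.ne hlow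
          (hint.mono_set hsub)
    _ ≤ _ := setIntegral_mono_set hint (ae_of_all _ fun z => by positivity)
        (LE.le.eventuallyLE hsub)

theorem not_tendsto_integral_norm_uLog_sq_div_pow {ε : ℝ} (hε : ε < 1) {m : ℕ} (hm : 3 ≤ m) :
    ¬ Tendsto (fun r : ℝ => (∫ z in ball (0 : ℂ) r, ‖uLog ε z‖ ^ 2) / r ^ m)
      (𝓝[>] (0 : ℝ)) (𝓝 0) := by
  intro h
  have hpi : (0 : ℝ) < Real.pi / 32 := by positivity
  refine absurd (ge_of_tendsto h ?_) hpi.not_ge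
  filter_upwards [eventually_le_integral_norm_uLog_sq hε,
    Ioo_mem_nhdsGT (zero_lt_one' ℝ)] with r hle hr
  have hr0 : 0 < r := hr.1
  rw [le_div_iff₀ (by positivity)]
  refine le_trans ?_ hle
  gcongr Real.pi / 32 * ?_
  exact pow_le_pow_of_le_one hr0.le hr.2.le hm

/-- **An example with an exactly-`L²` potential.**  Fix `0 < ε < 1/2` and let
`u₀(z) = e^{−(−ln|z|)^ε}` and `V(z) = ε/(2|z|(−ln|z|)^{1−ε})` on `D_{1/2} \ {0}`.  Then
(i) `V ∈ L²(D_{1/2})`; (ii) `V ∉ L^p(D_{1/2})` for every `p > 2`; (iii) `u₀` is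
differentiable on `D_{1/2} \ {0}` and satisfies `|∂̄u₀(z)| = V(z)|u₀(z)|` there; and
(iv) `u₀` does not vanish to infinite order at `0`: for every `m ≥ 3`, the quantity
`r^{−m} ∫_{|z|<r} |u₀|² dv` does not tend to `0` as `r → 0⁺`. -/
theorem exactly_L2_potential_example (ε : ℝ) (hε0 : 0 < ε) (hε : ε < 1 / 2) :
    (∫⁻ z in ball (0 : ℂ) (1 / 2), ENNReal.ofReal (VLog ε z ^ 2)) < ⊤ ∧
    (∀ p : ℝ, 2 < p →
      (∫⁻ z in ball (0 : ℂ) (1 / 2), ENNReal.ofReal (VLog ε z ^ p)) = ⊤) ∧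
    (∀ z : ℂ, z ∈ ball (0 : ℂ) (1 / 2) → z ≠ 0 →
      DifferentiableAt ℝ (uLog ε) z ∧ ‖dbar (uLog ε) z‖ = VLog ε z * ‖uLog ε z‖) ∧
    (∀ m : ℕ, 3 ≤ m →
      ¬ Tendsto (fun r : ℝ => (∫ z in ball (0 : ℂ) r, ‖uLog ε z‖ ^ 2) / r ^ m)
        (𝓝[>] (0 : ℝ)) (𝓝 0)) := by
  refine ⟨lintegral_VLog_sq_lt_top hε,
    fun p hp => lintegral_VLog_rpow_eq_top hε0 (by linarith) hp, fun z hz hz0 => ?_,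
    fun m hm => not_tendsto_integral_norm_uLog_sq_div_pow (by linarith) hm⟩
  exact differentiableAt_uLog_and_norm_dbar hε0.le
    (by linarith [mem_ball_zero_iff.1 hz]) hz0
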